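/- (Backward-forward Lemma) Let F be a fact base, 𝒬 a UCQ and R a disjunctive rule. For any disjunctive piece-unifier μ_∨ of 𝒬 with R, if F ⊨ β_∨(𝒬, R, μ_∨) then there is a trigger (R, h) on F such that α_∨(F, R, h) ⊨ 𝒬. -/

import Mathlib

/-! ## Basic syntax: terms, atoms, substitutions -/

/-- A term over variables `V` and constants `C`. -/
inductive FOTerm (V C : Type) where
  | var (v : V)
  | const (c : C)
deriving DecidableEq

/-- An atom `p(t_1,...,t_n)`. -/
structure FOAtom (P V C : Type) where
  pred : P
  args : List (FOTerm V C)
deriving DecidableEq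

/-- A substitution of variables by terms. -/
abbrev FOSubst (V C : Type) := V → FOTerm V C

variable {P V C : Type}

def FOTerm.applySub (u : FOSubst V C) : FOTerm V C → FOTerm V C
  | FOTerm.var v => u v
  | FOTerm.const c => FOTerm.const c

def FOAtom.applySub (u : FOSubst V C) (a : FOAtom P V C) : FOAtom P V C :=
  ⟨a.pred, a.args.map (FOTerm.applySub u)⟩

def applySubFS [DecidableEq P] [DecidableEq V] [DecidableEq C]
    (u : FOSubst V C) (S : Finset (FOAtom P V C)) : Finset (FOAtom P V C) :=
  S.image (FOAtom.applySub u)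

def FOTerm.varsOf [DecidableEq V] : FOTerm V C → Finset V
  | FOTerm.var v => {v}
  | FOTerm.const _ => ∅

def FOAtom.varsOf [DecidableEq V] (a : FOAtom P V C) : Finset V :=
  a.args.foldr (fun t acc => t.varsOf ∪ acc) ∅

/-- Variables occurring in a finite set of atoms. -/
def varsFS [DecidableEq V] (S : Finset (FOAtom P V C)) : Finset V :=
  S.sup FOAtom.varsOf

/-- Terms occurring in a finite set of atoms. -/
def termsFS [DecidableEq V] [DecidableEq C] (S : Finset (FOAtom P V C)) :
    Finset (FOTerm V C) :=
  S.sup (fun a => a.args.toFinset)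

/-- `h` is a homomorphism from the atom set `S₁` to the atom set `S₂`. -/
def IsHom (h : FOSubst V C) (S₁ S₂ : Finset (FOAtom P V C)) : Prop :=
  ∀ a ∈ S₁, a.applySub h ∈ S₂

/-- `S₂ ⊨ S₁` for atom sets viewed as existentially closed conjunctions:
there is a homomorphism from `S₁` to `S₂`. -/
def EntailsFS (S₂ S₁ : Finset (FOAtom P V C)) : Prop :=
  ∃ h : FOSubst V C, IsHom h S₁ S₂

/-! ## Disjunctive existential rules, triggers, chase step α -/

/-- A disjunctive existential rule `B → H₁ ∨ ... ∨ Hₙ`. -/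
structure DisjRule (P V C : Type) where
  body : Finset (FOAtom P V C)
  heads : List (Finset (FOAtom P V C))

/-- Well-formedness: non-empty body, at least one head disjunct, non-empty disjuncts. -/
def DisjRule.WF (R : DisjRule P V C) : Prop :=
  R.body.Nonempty ∧ R.heads ≠ [] ∧ ∀ H ∈ R.heads, H.Nonempty

/-- All variables of a rule. -/
def DisjRule.vars [DecidableEq V] (R : DisjRule P V C) : Finset V :=
  varsFS R.body ∪ R.heads.foldr (fun H acc => varsFS H ∪ acc) ∅

/-- A trigger `(R, h)` on `F`: `h` is a homomorphism from the body of `R` to `F`. -/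
def IsTrigger (R : DisjRule P V C) (h : FOSubst V C) (F : Finset (FOAtom P V C)) : Prop :=
  IsHom h R.body F

/-- `h'` is a safe extension of `h` for the head disjunct `H` of rule `R` w.r.t. the
fact base `F`: it agrees with `h` outside the existential variables of `H` and renames
the existential variables of `H` injectively to fresh variables. -/
def IsSafeExt [DecidableEq V] (F : Finset (FOAtom P V C)) (R : DisjRule P V C)
    (H : Finset (FOAtom P V C)) (h h' : FOSubst V C) : Prop :=
  (∀ v : V, v ∉ varsFS H \ varsFS R.body → h' v = h v) ∧
  (∀ v ∈ varsFS H \ varsFS R.body, ∃ w : V, h' v = FOTerm.var w ∧ w ∉ varsFS F) ∧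
  (∀ v ∈ varsFS H \ varsFS R.body, ∀ v' ∈ varsFS H \ varsFS R.body,
      h' v = h' v' → v = v')

/-- `L` is a result of the application `α_∨(F, R, h)` of the trigger `(R, h)` on `F`:
its `i`-th element is `F ∪ h^{safeᵢ}(Hᵢ)`. -/
def IsAlpha [DecidableEq P] [DecidableEq V] [DecidableEq C]
    (F : Finset (FOAtom P V C)) (R : DisjRule P V C) (h : FOSubst V C)
    (L : List (Finset (FOAtom P V C))) : Prop :=
  L.length = R.heads.length ∧
  ∀ (i : ℕ) (hi : i < L.length) (hi' : i < R.heads.length),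
    ∃ h' : FOSubst V C, IsSafeExt F R (R.heads.get ⟨i, hi'⟩) h h' ∧
      L.get ⟨i, hi⟩ = F ∪ applySubFS h' (R.heads.get ⟨i, hi'⟩)

/-! ## Partitions of terms (as equivalence relations), piece-unifiers -/

/-- A relation on terms, representing a partition of a set of terms (two terms are
related iff they belong to the same class). -/
abbrev TRel (V C : Type) := FOTerm V C → FOTerm V C → Prop

/-- Admissibility of a partition: no class contains two distinct constants. -/
def RelAdmissible (r : TRel V C) : Prop :=
  ∀ c c' : C, r (FOTerm.const c) (FOTerm.const c') → c = c'

/-- `u` is a substitution associated with the partition represented by `r`: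
it is constant on classes, maps each term to a member of its class (the selected term),
and gives priority to constants. -/
def IsAssocSub (r : TRel V C) (u : FOSubst V C) : Prop :=
  (∀ s t, r s t → s.applySub u = t.applySub u) ∧
  (∀ t, r t (t.applySub u)) ∧
  (∀ (v : V) (c : C), r (FOTerm.var v) (FOTerm.const c) → u v = FOTerm.const c)

/-- The data of a piece-unifier `(Q', H', P_u)`. -/
structure PieceUnif (P V C : Type) where
  Q' : Finset (FOAtom P V C)
  H' : Finset (FOAtom P V C)
  rel : TRel V C

/-- `μ` is a piece-unifier of the CQ `Q` with the conjunctive rule `B → H`. -/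
def IsPieceUnifier [DecidableEq P] [DecidableEq V] [DecidableEq C]
    (Q : Finset (FOAtom P V C)) (B H : Finset (FOAtom P V C))
    (μ : PieceUnif P V C) : Prop :=
  μ.Q'.Nonempty ∧ μ.Q' ⊆ Q ∧ μ.H' ⊆ H ∧
  Equivalence μ.rel ∧
  -- the partition is on the terms of Q' and H' (all other classes are singletons)
  (∀ s t, μ.rel s t → s = t ∨
      (s ∈ termsFS μ.Q' ∪ termsFS μ.H' ∧ t ∈ termsFS μ.Q' ∪ termsFS μ.H')) ∧
  RelAdmissible μ.rel ∧
  -- classes containing an existential variable of H' contain otherwise only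
  -- non-separating variables of Q'
  (∀ z ∈ varsFS μ.H' \ varsFS B, ∀ t, μ.rel (FOTerm.var z) t → t = FOTerm.var z ∨
      ∃ v : V, t = FOTerm.var v ∧ FOTerm.var v ∈ termsFS μ.Q' ∧ v ∉ varsFS (Q \ μ.Q')) ∧
  -- unification condition
  (∀ u : FOSubst V C, IsAssocSub μ.rel u → applySubFS u μ.Q' = applySubFS u μ.H')

/-- The join of a list of partitions (represented as relations): the equivalence
relation generated by their union. -/
def joinRel (rs : List (TRel V C)) : TRel V C :=
  Relation.EqvGen (fun s t => ∃ r ∈ rs, r s t)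

/-- The data of a disjunctive piece-unifier: the safe copies `Q₁, ..., Qₙ` together
with the conjunctive piece-unifiers `μ₁, ..., μₙ`. -/
structure DisjPieceUnif (P V C : Type) where
  Qs : List (Finset (FOAtom P V C))
  mus : List (PieceUnif P V C)

/-- The join of the partitions of a disjunctive piece-unifier. -/
def DisjPieceUnif.rel (μ : DisjPieceUnif P V C) : TRel V C :=
  joinRel (μ.mus.map PieceUnif.rel)

/-- `Qc` is a safe copy of `Q` (bijective renaming of its variables). -/
def IsSafeCopy [DecidableEq P] [DecidableEq V] [DecidableEq C]
    (Q Qc : Finset (FOAtom P V C)) : Prop :=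
  ∃ ρ : V → V, Function.Injective ρ ∧
    Qc = Q.image (FOAtom.applySub (fun v => FOTerm.var (ρ v)))

/-- `μ` is a disjunctive piece-unifier of the UCQ `𝒬` with the disjunctive rule `R`. -/
def IsDisjPieceUnifier [DecidableEq P] [DecidableEq V] [DecidableEq C]
    (𝒬 : Set (Finset (FOAtom P V C))) (R : DisjRule P V C)
    (μ : DisjPieceUnif P V C) : Prop :=
  μ.Qs.length = R.heads.length ∧ μ.mus.length = R.heads.length ∧
  -- each Qᵢ is a safe copy of a CQ of 𝒬, with variables disjoint from the rule
  -- and from the other copies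
  (∀ (i : ℕ) (hi : i < μ.Qs.length), ∃ Q ∈ 𝒬, IsSafeCopy Q (μ.Qs.get ⟨i, hi⟩)) ∧
  (∀ (i : ℕ) (hi : i < μ.Qs.length), Disjoint (varsFS (μ.Qs.get ⟨i, hi⟩)) R.vars) ∧
  (∀ (i j : ℕ) (hi : i < μ.Qs.length) (hj : j < μ.Qs.length), i ≠ j →
      Disjoint (varsFS (μ.Qs.get ⟨i, hi⟩)) (varsFS (μ.Qs.get ⟨j, hj⟩))) ∧
  -- each μᵢ is a piece-unifier of Qᵢ with B → Hᵢ
  (∀ (i : ℕ) (hi : i < R.heads.length) (hi1 : i < μ.Qs.length) (hi2 : i < μ.mus.length),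
      IsPieceUnifier (μ.Qs.get ⟨i, hi1⟩) R.body (R.heads.get ⟨i, hi⟩)
        (μ.mus.get ⟨i, hi2⟩)) ∧
  -- the join of the partitions is admissible
  RelAdmissible μ.rel

/-- `β_∨(𝒬, R, μ) = u(B) ∪ ⋃ᵢ u(Qᵢ ∖ Qᵢ')`, for `u` a substitution associated with
the join of the partitions of `μ`. -/
def betaRw [DecidableEq P] [DecidableEq V] [DecidableEq C]
    (R : DisjRule P V C) (μ : DisjPieceUnif P V C) (u : FOSubst V C) :
    Finset (FOAtom P V C) :=
  applySubFS u R.body ∪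
    (List.zipWith (fun Qi m => applySubFS u (Qi \ PieceUnif.Q' m)) μ.Qs μ.mus).foldr
      (· ∪ ·) ∅

/-! ## Semantics -/

/-- A first-order interpretation (with non-empty domain). -/
structure Interp (P V C : Type) where
  dom : Type
  nonempty : Nonempty dom
  rel : P → List dom → Prop
  cst : C → dom

def Interp.evalT (I : Interp P V C) (a : V → I.dom) : FOTerm V C → I.dom
  | FOTerm.var v => a v
  | FOTerm.const c => I.cst c

def Interp.satAtom (I : Interp P V C) (a : V → I.dom) (atm : FOAtom P V C) : Prop :=
  I.rel atm.pred (atm.args.map (I.evalT a))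

def Interp.satFS (I : Interp P V C) (a : V → I.dom) (S : Finset (FOAtom P V C)) : Prop :=
  ∀ atm ∈ S, I.satAtom a atm

/-- `I` is a model of the atom set `S` viewed as an existentially closed conjunction. -/
def Interp.modelsFB [DecidableEq V] (I : Interp P V C) (S : Finset (FOAtom P V C)) : Prop :=
  ∃ a : V → I.dom, I.satFS a S

/-- `I` satisfies the disjunctive existential rule `R`. -/
def Interp.satRule [DecidableEq V] (I : Interp P V C) (R : DisjRule P V C) : Prop :=
  ∀ a : V → I.dom, I.satFS a R.body →
    ∃ H ∈ R.heads, ∃ a' : V → I.dom,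
      (∀ v ∈ varsFS R.body, a' v = a v) ∧ I.satFS a' H

/-- First-order entailment `F, ℛ ⊨ 𝒬` of a UCQ from a fact base and a set of
disjunctive existential rules. -/
def SemEntails [DecidableEq V] (F : Finset (FOAtom P V C)) (ℛ : Set (DisjRule P V C))
    (𝒬 : Set (Finset (FOAtom P V C))) : Prop :=
  ∀ I : Interp P V C, I.modelsFB F → (∀ R ∈ ℛ, I.satRule R) →
    ∃ Q ∈ 𝒬, I.modelsFB Q

/-! ## Piece-rewriting -/

/-- `IsPieceRewriting ℛ 𝒬 𝒬'` holds when the UCQ `𝒬'` is obtained from the UCQ `𝒬`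
by a finite sequence of one-step piece-rewritings with rules of `ℛ`. -/
inductive IsPieceRewriting [DecidableEq P] [DecidableEq V] [DecidableEq C]
    (ℛ : Set (DisjRule P V C)) :
    Finset (Finset (FOAtom P V C)) → Finset (Finset (FOAtom P V C)) → Prop
  | refl (𝒬 : Finset (Finset (FOAtom P V C))) : IsPieceRewriting ℛ 𝒬 𝒬
  | step (𝒬 𝒬' : Finset (Finset (FOAtom P V C))) (R : DisjRule P V C)
      (μ : DisjPieceUnif P V C) (u : FOSubst V C) :
      IsPieceRewriting ℛ 𝒬 𝒬' → R ∈ ℛ →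
      IsDisjPieceUnifier (↑𝒬' : Set (Finset (FOAtom P V C))) R μ →
      IsAssocSub μ.rel u →
      IsPieceRewriting ℛ 𝒬 (insert (betaRw R μ u) 𝒬')

theorem FOAtom.mem_varsOf [DecidableEq V] {a : FOAtom P V C} {v : V} :
    v ∈ a.varsOf ↔ FOTerm.var v ∈ a.args := by
  obtain ⟨p, l⟩ := a
  simp only [FOAtom.varsOf]
  induction l with
  | nil => simp
  | cons t l ih =>
    rw [List.foldr_cons, Finset.mem_union, ih]
    cases t <;> simp [FOTerm.varsOf]

theorem mem_varsFS [DecidableEq V] {S : Finset (FOAtom P V C)} {v : V} :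
    v ∈ varsFS S ↔ ∃ a ∈ S, FOTerm.var v ∈ a.args := by
  simp [varsFS, Finset.mem_sup, FOAtom.mem_varsOf]

theorem mem_termsFS [DecidableEq V] [DecidableEq C] {S : Finset (FOAtom P V C)}
    {t : FOTerm V C} : t ∈ termsFS S ↔ ∃ a ∈ S, t ∈ a.args := by
  simp [termsFS, Finset.mem_sup]

theorem varsFS_mono [DecidableEq V] {S T : Finset (FOAtom P V C)} (h : S ⊆ T) :
    varsFS S ⊆ varsFS T :=
  Finset.sup_mono h

theorem DisjRule.varsFS_head_subset [DecidableEq V] {R : DisjRule P V C}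
    {H : Finset (FOAtom P V C)} (hH : H ∈ R.heads) : varsFS H ⊆ R.vars := by
  have key : ∀ l : List (Finset (FOAtom P V C)), H ∈ l →
      varsFS H ⊆ l.foldr (fun H acc => varsFS H ∪ acc) ∅ := by
    intro l
    induction l with
    | nil => simp
    | cons K l ih =>
      intro h
      rcases List.mem_cons.1 h with rfl | h
      · exact Finset.subset_union_left
      · exact (ih h).trans Finset.subset_union_right
  exact (key _ hH).trans Finset.subset_union_right

theorem FOAtom.applySub_congr {g h : FOSubst V C} {a : FOAtom P V C}
    (H : ∀ v, FOTerm.var v ∈ a.args → g v = h v) : a.applySub g = a.applySub h := by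
  simp only [FOAtom.applySub, FOAtom.mk.injEq, true_and]
  refine List.map_congr_left fun t ht => ?_
  cases t with
  | var v => exact H v ht
  | const c => rfl

theorem FOAtom.applySub_applySub (g u : FOSubst V C) (a : FOAtom P V C) :
    (a.applySub u).applySub g = a.applySub (fun v => (u v).applySub g) := by
  simp only [FOAtom.applySub, List.map_map, FOAtom.mk.injEq, true_and]
  refine List.map_congr_left fun t _ => ?_
  cases t <;> rfl

/-- Every admissible equivalence relation on terms has an associated substitution. -/
theorem exists_isAssocSub {r : TRel V C} (hr : Equivalence r) (ha : RelAdmissible r) :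
    ∃ u, IsAssocSub r u := by
  classical
  let st : Setoid (FOTerm V C) := ⟨r, hr⟩
  let rep : FOTerm V C → FOTerm V C := fun t =>
    if h : ∃ c, r t (FOTerm.const c) then FOTerm.const h.choose
    else (Quotient.mk st t).out
  have rep_rel : ∀ t, r t (rep t) := by
    intro t
    by_cases h : ∃ c, r t (FOTerm.const c)
    · simpa only [rep, dif_pos h] using h.choose_spec
    · simpa only [rep, dif_neg h] using hr.symm (Quotient.mk_out (s := st) t)
  have rep_const : ∀ t c, r t (FOTerm.const c) → rep t = FOTerm.const c := by
    intro t c h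
    have h' : ∃ c, r t (FOTerm.const c) := ⟨c, h⟩
    simp only [rep, dif_pos h']
    rw [ha _ _ (hr.trans (hr.symm h'.choose_spec) h)]
  have rep_eq : ∀ s t, r s t → rep s = rep t := by
    intro s t hst
    by_cases h : ∃ c, r t (FOTerm.const c)
    · obtain ⟨c, hc⟩ := h
      rw [rep_const t c hc, rep_const s c (hr.trans hst hc)]
    · have h' : ¬ ∃ c, r s (FOTerm.const c) :=
        fun ⟨c, hc⟩ => h ⟨c, hr.trans (hr.symm hst) hc⟩
      simp only [rep, dif_neg h, dif_neg h']
      rw [Quotient.sound (s := st) hst]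
  have app : ∀ t : FOTerm V C, t.applySub (fun v => rep (FOTerm.var v)) = rep t := by
    intro t
    cases t with
    | var v => rfl
    | const c => exact (rep_const _ c (hr.refl _)).symm
  refine ⟨fun v => rep (FOTerm.var v), fun s t h => ?_, fun t => ?_, fun v c h => ?_⟩
  · rw [app, app, rep_eq s t h]
  · rw [app]
    exact rep_rel t
  · exact rep_const _ c h

theorem exists_isSafeExt [DecidableEq V] [Infinite V] (F : Finset (FOAtom P V C))
    (R : DisjRule P V C) (H : Finset (FOAtom P V C)) (h : FOSubst V C) :
    ∃ h', IsSafeExt F R H h h' := by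
  classical
  set E := varsFS H \ varsFS R.body
  have hinf : Infinite {w : V // w ∉ varsFS F} :=
    ((varsFS F).finite_toSet.infinite_compl).to_subtype
  let fresh : ℕ ↪ {w : V // w ∉ varsFS F} := Infinite.natEmbedding _
  let f : E → V := fun v => fresh (E.equivFin v)
  have f_inj : Function.Injective f := fun v v' hv =>
    E.equivFin.injective (Fin.ext (fresh.injective (Subtype.ext hv)))
  refine ⟨fun v => if hv : v ∈ E then FOTerm.var (f ⟨v, hv⟩) else h v,
    fun v hv => dif_neg hv, fun v hv => ⟨f ⟨v, hv⟩, dif_pos hv, (fresh _).2⟩, ?_⟩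
  intro v hv v' hv' heq
  simp only [dif_pos (show v ∈ E from hv), dif_pos (show v' ∈ E from hv'),
    FOTerm.var.injEq] at heq
  exact congrArg Subtype.val (f_inj heq)

/-- If `h` is constant on the classes of a piece-unifier of `Q` with `R.body → H` and maps the
part of `Q` that is not unified to `F`, then `F` extended with the safe image of `H` entails
`Q`. -/
theorem IsPieceUnifier.entails [DecidableEq P] [DecidableEq V] [DecidableEq C]
    {F Q H : Finset (FOAtom P V C)} {R : DisjRule P V C} {m : PieceUnif P V C}
    (hm : IsPieceUnifier Q R.body H m) (hH : H ∈ R.heads)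
    (hdisj : Disjoint (varsFS Q) R.vars) {h h' : FOSubst V C}
    (hrel : ∀ s t, m.rel s t → s.applySub h = t.applySub h)
    (hF : IsHom h (Q \ m.Q') F) (hsafe : IsSafeExt F R H h h') :
    EntailsFS (F ∪ applySubFS h' H) Q := by
  classical
  obtain ⟨-, hQ', hH', heqv, -, hadm, hpiece, hunif⟩ := hm
  obtain ⟨w, hw⟩ := exists_isAssocSub heqv hadm
  set E := varsFS m.H' \ varsFS R.body
  have E_vars : ∀ {z}, z ∈ E → z ∈ R.vars := fun hz =>
    R.varsFS_head_subset hH (varsFS_mono hH' (Finset.mem_sdiff.1 hz).1)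
  have Q'_vars : ∀ {v}, FOTerm.var v ∈ termsFS m.Q' → v ∉ R.vars := fun hv =>
    Finset.disjoint_left.1 hdisj (varsFS_mono hQ' (mem_varsFS.2 (mem_termsFS.1 hv)))
  have class_rule : ∀ {z v}, z ∈ E → v ∈ R.vars → m.rel (FOTerm.var z) (FOTerm.var v) →
      v = z := by
    intro z v hz hv hzv
    rcases hpiece z hz _ hzv with h | ⟨v', h, hv', -⟩
    · exact FOTerm.var.inj h
    · cases h
      exact absurd hv (Q'_vars hv')
  let g : FOTerm V C → FOTerm V C := fun t =>
    if hz : ∃ z ∈ E, m.rel (FOTerm.var z) t then h' hz.choose else t.applySub h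
  have g_exist : ∀ z ∈ E, ∀ t, m.rel (FOTerm.var z) t → g t = h' z := by
    intro z hz t hzt
    have hex : ∃ z ∈ E, m.rel (FOTerm.var z) t := ⟨z, hz, hzt⟩
    simp only [g, dif_pos hex]
    rw [class_rule hz (E_vars hex.choose_spec.1)
      (heqv.trans hzt (heqv.symm hex.choose_spec.2))]
  have g_other : ∀ t, (¬ ∃ z ∈ E, m.rel (FOTerm.var z) t) → g t = t.applySub h :=
    fun t ht => dif_neg ht
  have g_rel : ∀ s t, m.rel s t → g s = g t := by
    intro s t hst
    by_cases hex : ∃ z ∈ E, m.rel (FOTerm.var z) s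
    · obtain ⟨z, hz, hzs⟩ := hex
      rw [g_exist z hz s hzs, g_exist z hz t (heqv.trans hzs hst)]
    · rw [g_other s hex, g_other t fun ⟨z, hz, hzt⟩ =>
        hex ⟨z, hz, heqv.trans hzt (heqv.symm hst)⟩, hrel s t hst]
  let γ : FOSubst V C := fun v => g (FOTerm.var v)
  have g_app : ∀ t : FOTerm V C, t.applySub γ = g t := by
    intro t
    cases t with
    | var v => rfl
    | const c =>
      refine (g_other (FOTerm.const c) ?_).symm
      rintro ⟨z, hz, hzc⟩
      rcases hpiece z hz _ hzc with h | ⟨v, h, -⟩ <;> cases h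
  have g_assoc : ∀ a : FOAtom P V C, (a.applySub w).applySub γ = a.applySub γ := by
    intro a
    rw [FOAtom.applySub_applySub]
    refine FOAtom.applySub_congr fun v _ => ?_
    rw [g_app]
    exact (g_rel _ _ (hw.2.1 (FOTerm.var v))).symm
  have g_head : ∀ b ∈ m.H', b.applySub γ = b.applySub h' := by
    intro b hb
    refine FOAtom.applySub_congr fun v hv => ?_
    have hvH : v ∈ varsFS m.H' := mem_varsFS.2 ⟨b, hb, hv⟩
    by_cases hvB : v ∈ varsFS R.body
    · rw [hsafe.1 v fun hv => (Finset.mem_sdiff.1 hv).2 hvB]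
      refine g_other _ ?_
      rintro ⟨z, hz, hzv⟩
      have := class_rule hz (Finset.mem_union_left _ hvB) hzv
      subst this
      exact (Finset.mem_sdiff.1 hz).2 hvB
    · exact g_exist v (Finset.mem_sdiff.2 ⟨hvH, hvB⟩) _ (heqv.refl _)
  refine ⟨γ, fun a ha => ?_⟩
  by_cases haQ' : a ∈ m.Q'
  · have hmem : a.applySub w ∈ applySubFS w m.H' :=
      hunif w hw ▸ Finset.mem_image_of_mem _ haQ'
    obtain ⟨b, hb, hba⟩ := Finset.mem_image.1 hmem
    rw [← g_assoc a, ← hba, g_assoc b, g_head b hb]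
    exact Finset.mem_union_right _ (Finset.mem_image_of_mem _ (hH' hb))
  · have haS : a ∈ Q \ m.Q' := Finset.mem_sdiff.2 ⟨ha, haQ'⟩
    have : a.applySub γ = a.applySub h := by
      refine FOAtom.applySub_congr fun v hv => g_other _ ?_
      rintro ⟨z, hz, hzv⟩
      rcases hpiece z hz _ hzv with h | ⟨v', h, -, hv'⟩
      · cases h
        exact Finset.disjoint_left.1 hdisj (mem_varsFS.2 ⟨a, ha, hv⟩) (E_vars hz)
      · cases h
        exact hv' (mem_varsFS.2 ⟨a, haS, hv⟩)
    rw [this]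
    exact Finset.mem_union_left _ (hF a haS)

theorem EntailsFS.of_isSafeCopy [DecidableEq P] [DecidableEq V] [DecidableEq C]
    {G Q Qc : Finset (FOAtom P V C)} (hG : EntailsFS G Qc) (hQ : IsSafeCopy Q Qc) :
    EntailsFS G Q := by
  obtain ⟨g, hg⟩ := hG
  obtain ⟨ρ, -, rfl⟩ := hQ
  refine ⟨fun v => g (ρ v), fun a ha => ?_⟩
  have := hg _ (Finset.mem_image_of_mem _ ha)
  rwa [FOAtom.applySub_applySub] at this

theorem subset_foldr_union {α : Type*} [DecidableEq α] {l : List (Finset α)} {S : Finset α}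
    (h : S ∈ l) : S ⊆ l.foldr (· ∪ ·) ∅ := by
  induction l with
  | nil => simp at h
  | cons T l ih =>
    rcases List.mem_cons.1 h with rfl | h
    · exact Finset.subset_union_left
    · exact (ih h).trans Finset.subset_union_right

theorem applySubFS_sdiff_subset_betaRw [DecidableEq P] [DecidableEq V] [DecidableEq C]
    (R : DisjRule P V C) (μ : DisjPieceUnif P V C) (u : FOSubst V C) {i : ℕ}
    (hQ : i < μ.Qs.length) (hm : i < μ.mus.length) :
    applySubFS u (μ.Qs[i] \ μ.mus[i].Q') ⊆ betaRw R μ u := by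
  refine (subset_foldr_union ?_).trans Finset.subset_union_right
  exact List.mem_iff_getElem.2 ⟨i, by simp [hQ, hm], by simp⟩

/-- Backward-forward Lemma: for any disjunctive piece-unifier `μ_∨` of
`𝒬` with `R`, if `F ⊨ β_∨(𝒬, R, μ_∨)` then there is a trigger `(R, h)` on `F` such
that `α_∨(F, R, h) ⊨ 𝒬`. -/
theorem stmt5 {P V C : Type} [DecidableEq P] [DecidableEq V] [DecidableEq C] [Infinite V]
    (F : Finset (FOAtom P V C)) (𝒬 : Finset (Finset (FOAtom P V C)))
    (R : DisjRule P V C) (hWF : R.WF)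
    (μ : DisjPieceUnif P V C)
    (hμ : IsDisjPieceUnifier (↑𝒬 : Set (Finset (FOAtom P V C))) R μ)
    (u : FOSubst V C) (hu : IsAssocSub μ.rel u)
    (hent : EntailsFS F (betaRw R μ u)) :
    ∃ h : FOSubst V C, IsTrigger R h F ∧
      ∃ L : List (Finset (FOAtom P V C)), IsAlpha F R h L ∧
        ∀ G ∈ L, ∃ Q ∈ 𝒬, EntailsFS G Q := by
  obtain ⟨e, he⟩ := hent
  obtain ⟨hlQ, hlm, hcopy, hdisj, -, hpu, -⟩ := hμ
  let h : FOSubst V C := fun v => (u v).applySub e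
  have h_app : ∀ t : FOTerm V C, t.applySub h = (t.applySub u).applySub e := by
    intro t
    cases t <;> rfl
  have h_atom : ∀ (a : FOAtom P V C) (S : Finset (FOAtom P V C)), a ∈ S →
      applySubFS u S ⊆ betaRw R μ u → a.applySub h ∈ F := by
    intro a S ha hS
    have := he _ (hS (Finset.mem_image_of_mem _ ha))
    rwa [FOAtom.applySub_applySub] at this
  choose safe hsafe using fun H => exists_isSafeExt F R H h
  refine ⟨h, fun a ha => h_atom a _ ha Finset.subset_union_left,
    R.heads.map fun H => F ∪ applySubFS (safe H) H, ⟨by simp, ?_⟩, ?_⟩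
  · intro i _ hi
    exact ⟨safe _, hsafe _, by simp⟩
  · intro G hG
    obtain ⟨H, hH, rfl⟩ := List.mem_map.1 hG
    obtain ⟨i, hi, rfl⟩ := List.mem_iff_getElem.1 hH
    have hiQ : i < μ.Qs.length := hlQ ▸ hi
    have him : i < μ.mus.length := hlm ▸ hi
    obtain ⟨Q, hQ, hQc⟩ := hcopy i hiQ
    refine ⟨Q, hQ, EntailsFS.of_isSafeCopy ?_ hQc⟩
    refine (hpu i hi hiQ him).entails hH (hdisj i hiQ) (fun s t hst => ?_)
      (fun a ha => h_atom a _ ha (applySubFS_sdiff_subset_betaRw R μ u hiQ him)) (hsafe _)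
    rw [h_app, h_app, hu.1 s t (Relation.EqvGen.rel _ _
      ⟨_, List.mem_map_of_mem (List.getElem_mem him), hst⟩)]
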